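/- Assume [F_q : F_p] is even, so n := [F_q:F_2] is even. Let W ⊆ F_q be an F_p-subspace with 1 ∈ W and dim_{F_p} W = e, and let t ∈ F_q satisfy Q_q(v) = ψ_q(tv) for all v ∈ W. Write f_W(x) := ∏_{v ∈ W}(x − v) = ∑_{i=0}^e c_i x^{p^i} (an F_p-linearized polynomial), and set F_W(x) := ∑_{i=0}^e c_i^{p^{−i}} x^{p^{e−i}}. Let N := |{(x,y) ∈ F_q × F_q : y^p − y = x·R_{F_W,t}(x)}|. Then N = q + (p−1)p^e·2^{n/2} or N = q − (p−1)p^e·2^{n/2}; moreover N = q + (p−1)p^e·2^{n/2} if and only if Q_q(t) = −(√−1)^{n/2}, and N = q − (p−1)p^e·2^{n/2} if and only if Q_q(t) = (√−1)^{n/2}. -/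

import Mathlib

open Finset

open scoped Classical

noncomputable section

/-- Length-two Witt vectors, with the operations specialised to characteristic two. -/
def W2 (R : Type*) := R × R

namespace W2

variable {R : Type*} [CommRing R]

instance : Zero (W2 R) := ⟨((0, 0) : R × R)⟩

instance : Add (W2 R) := ⟨fun x y => ((x.1 + y.1, x.2 + y.2 + x.1 * y.1) : R × R)⟩

instance [CharP R 2] : Neg (W2 R) := ⟨fun x => ((x.1, x.2 + x.1 * x.1) : R × R)⟩

theorem fst_add (x y : W2 R) : (x + y).1 = x.1 + y.1 := rfl
theorem snd_add (x y : W2 R) : (x + y).2 = x.2 + y.2 + x.1 * y.1 := rfl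
theorem fst_zero : (0 : W2 R).1 = 0 := rfl
theorem snd_zero : (0 : W2 R).2 = 0 := rfl
theorem fst_neg [CharP R 2] (x : W2 R) : (-x).1 = x.1 := rfl
theorem snd_neg [CharP R 2] (x : W2 R) : (-x).2 = x.2 + x.1 * x.1 := rfl

instance [CharP R 2] : AddCommGroup (W2 R) where
  add := (· + ·)
  zero := 0
  neg := Neg.neg
  add_assoc a b c := Prod.ext_iff.mpr (by
    constructor <;> simp only [fst_add, snd_add] <;> ring)
  zero_add a := Prod.ext_iff.mpr (by
    constructor <;> simp [fst_add, snd_add, fst_zero, snd_zero])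
  add_zero a := Prod.ext_iff.mpr (by
    constructor <;> simp [fst_add, snd_add, fst_zero, snd_zero])
  add_comm a b := Prod.ext_iff.mpr (by
    constructor <;> simp only [fst_add, snd_add] <;> ring)
  neg_add_cancel a := Prod.ext_iff.mpr (by
    constructor
    · simp only [fst_add, fst_neg, fst_zero]
      exact CharTwo.add_self_eq_zero a.1
    · simp only [snd_add, snd_neg, snd_zero, fst_neg]
      rw [show a.2 + a.1 * a.1 + a.2 + a.1 * a.1
            = (a.2 + a.2) + (a.1 * a.1 + a.1 * a.1) by ring]
      rw [CharTwo.add_self_eq_zero, CharTwo.add_self_eq_zero, add_zero])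
  nsmul := nsmulRec
  zsmul := zsmulRec

/-- Frobenius on length-two Witt vectors (characteristic two). -/
def frob (x : W2 R) : W2 R := ((x.1 ^ 2, x.2 ^ 2) : R × R)

/-- The Witt-vector trace `Tr_{q/2} = ∑_{i=0}^{n-1} Frobⁱ`. -/
def tr [CharP R 2] (n : ℕ) (x : W2 R) : W2 R := ∑ i ∈ Finset.range n, frob^[i] x

/-- The additive character of `W₂(𝔽₂)` determined by `ξ₂(1,0) = I`
(for `I` a fixed primitive fourth root of unity), evaluated on Witt vectors
whose components lie in the prime field `𝔽₂ = {0,1}`. -/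
def xi (I : ℂ) (x : W2 R) : ℂ := (if x.1 = 0 then 1 else I) * (if x.2 = 0 then 1 else -1)

end W2

variable {K : Type*}

/-- The absolute trace `Tr_{q/2} : 𝔽_q → 𝔽₂`, computed inside `K` (here `q = 2^n`). -/
def tr2 [Field K] (n : ℕ) (x : K) : K := ∑ i ∈ Finset.range n, x ^ 2 ^ i

/-- The relative trace `Tr_{q/p} : 𝔽_q → 𝔽_p ⊆ 𝔽_q`, computed inside `K`
(here `q = p^m`). -/
def trp [Field K] (p m : ℕ) (x : K) : K := ∑ i ∈ Finset.range m, x ^ p ^ i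

/-- The character `ψ_q(x) = (-1)^{Tr_{q/2}(x)}`. -/
def psiq [Field K] (n : ℕ) (x : K) : ℂ := if tr2 n x = 0 then 1 else -1

/-- The map `Q_q(x) = ξ₂(Tr_{q/2}(x,0))` on Witt vectors of length two. -/
def Qq [Field K] [CharP K 2] (I : ℂ) (n : ℕ) (x : K) : ℂ :=
  W2.xi I (W2.tr n (((x, 0) : K × K) : W2 K))

/-- The unique `2^j`-th root in a perfect field of characteristic two. -/
def rt (L : Type*) [Field L] [ExpChar L 2] [PerfectRing L 2] (j : ℕ) (x : L) : L :=
  (fun y => (frobeniusEquiv L 2).symm y)^[j] x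

/-- Evaluation of the `𝔽_p`-linearised polynomial `∑_{i=0}^{e} c_i x^{p^i}`. -/
def Lpoly [Field K] (p e : ℕ) (c : ℕ → K) (x : K) : K :=
  ∑ i ∈ Finset.range (e + 1), c i * x ^ p ^ i

/-- The adjoint `f^*(x) = ∑_{i=0}^{e} (c_i x)^{p^{-i}}` (with `p = 2^k`). -/
def adj [Field K] [ExpChar K 2] [PerfectRing K 2] (k e : ℕ) (c : ℕ → K) (x : K) : K :=
  ∑ i ∈ Finset.range (e + 1), rt K (k * i) (c i * x)

/-- Evaluation of the `𝔽_p`-linearised polynomial `∑_{i=1}^{e} c_i x^{p^i}`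
(no constant-in-`x` coefficient). -/
def LpolyIcc [Field K] (p e : ℕ) (c : ℕ → K) (x : K) : K :=
  ∑ i ∈ Finset.Icc 1 e, c i * x ^ p ^ i

/-- The adjoint `R^*(x) = ∑_{i=1}^{e} (c_i x)^{p^{-i}}` (with `p = 2^k`). -/
def adjIcc [Field K] [ExpChar K 2] [PerfectRing K 2] (k e : ℕ) (c : ℕ → K) (x : K) : K :=
  ∑ i ∈ Finset.Icc 1 e, rt K (k * i) (c i * x)

/-- The coefficients `a_i = ∑_{j=0}^{e-i} (b_j b_{j+i})^{p^{-j}}` of `R_F` (with `p = 2^k`). -/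
def aRF [Field K] [ExpChar K 2] [PerfectRing K 2] (k e : ℕ) (b : ℕ → K) (i : ℕ) : K :=
  ∑ j ∈ Finset.range (e - i + 1), rt K (k * j) (b j * b (j + i))

/-- The linearised polynomial `R_F(x) = ∑_{i=1}^{e} a_i x^{p^i}` (with `p = 2^k`). -/
def RF [Field K] [ExpChar K 2] [PerfectRing K 2] (k e : ℕ) (b : ℕ → K) (x : K) : K :=
  ∑ i ∈ Finset.Icc 1 e, aRF k e b i * x ^ (2 ^ k) ^ i

/-- `γ_F = ∑_{0 ≤ i < j ≤ e} b_i^{p^{-i}} b_j^{p^{-j}}` (with `p = 2^k`). -/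
def gammaF [Field K] [ExpChar K 2] [PerfectRing K 2] (k e : ℕ) (b : ℕ → K) : K :=
  ∑ i ∈ Finset.range (e + 1), ∑ j ∈ Finset.Ioo i (e + 1), rt K (k * i) (b i) * rt K (k * j) (b j)

/-- `α_F(t) = γ_F + F^*(t)²`. -/
def alphaF [Field K] [ExpChar K 2] [PerfectRing K 2] (k e : ℕ) (b : ℕ → K) (t : K) : K :=
  gammaF k e b + adj k e b t ^ 2

/-- `R_{F,t}(x) = R_F(x) + α_F(t) x`. -/
def RFt [Field K] [ExpChar K 2] [PerfectRing K 2] (k e : ℕ) (b : ℕ → K) (t x : K) : K :=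
  RF k e b x + alphaF k e b t * x

/-- The number of affine points of the van der Geer–van der Vlugt curve
`y^p - y = x R(x)` with coordinates in `K`. -/
def Ncount (K : Type*) [Field K] (p : ℕ) (R : K → K) : ℕ :=
  Nat.card {z : K × K // z.2 ^ p - z.2 = z.1 * R z.1}

/-- The adjoint `F^*` of `F(x) = ∑_{i=0}^{e} b_i x^{p^i}`, with coefficients `b_i ∈ K`,
viewed as a function on the algebraic closure `𝔽` of `K`. -/
def adjBar [Field K] [CharP K 2] (k e : ℕ) (b : ℕ → K) (x : AlgebraicClosure K) : AlgebraicClosure K :=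
  adj k e (fun i => algebraMap K (AlgebraicClosure K) (b i)) x

/-- `F(x) = ∑_{i=0}^{e} b_i x^{p^i}`, with coefficients `b_i ∈ K`, viewed as a function on
the algebraic closure `𝔽` of `K` (with `p = 2^k`). -/
def LpolyBar [Field K] [CharP K 2] (k e : ℕ) (b : ℕ → K) (x : AlgebraicClosure K) : AlgebraicClosure K :=
  Lpoly (2 ^ k) e (fun i => algebraMap K (AlgebraicClosure K) (b i)) x


/-- The coefficients of `F_W = (τ^{-e} f_W)^*`, where `f_W = ∑ c_i τ^i`:
the coefficient of `x^{p^j}` in `F_W` is `c_{e-j}^{p^{-(e-j)}}`. -/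
def bOfW {K : Type*} [Field K] [ExpChar K 2] [PerfectRing K 2] (k e : ℕ) (c : ℕ → K) :
    ℕ → K :=
  fun j => rt K (k * (e - j)) (c (e - j))

section helpers

set_option linter.unusedSectionVars false

namespace W2

variable {R : Type*} [CommRing R] [CharP R 2]

/-- constructor with the right type -/
def mk (a b : R) : W2 R := ((a, b) : R × R)

theorem fst_mk (a b : R) : (mk a b).1 = a := rfl
theorem snd_mk (a b : R) : (mk a b).2 = b := rfl

theorem frob_mk (a b : R) : frob (mk a b) = mk (a ^ 2) (b ^ 2) := rfl

theorem ext' {x y : W2 R} (h1 : x.1 = y.1) (h2 : x.2 = y.2) : x = y := Prod.ext h1 h2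

theorem frob_add (x y : W2 R) : frob (x + y) = frob x + frob y := by
  apply ext'
  · change (x.1 + y.1) ^ 2 = x.1 ^ 2 + y.1 ^ 2
    exact CharTwo.add_sq _ _
  · change (x.2 + y.2 + x.1 * y.1) ^ 2 = x.2 ^ 2 + y.2 ^ 2 + x.1 ^ 2 * y.1 ^ 2
    rw [CharTwo.add_sq, CharTwo.add_sq, mul_pow]

theorem frob_iter (i : ℕ) (a b : R) :
    frob^[i] (W2.mk a b) = mk (a ^ 2 ^ i) (b ^ 2 ^ i) := by
  induction i with
  | zero => simp
  | succ i ih =>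
    rw [Function.iterate_succ_apply', ih]
    rw [frob_mk, ← pow_mul, ← pow_mul, ← pow_succ]

theorem frob_iter_add (i : ℕ) (x y : W2 R) : frob^[i] (x + y) = frob^[i] x + frob^[i] y := by
  induction i with
  | zero => simp
  | succ i ih => simp only [Function.iterate_succ_apply', ih, frob_add]

theorem tr_add (n : ℕ) (x y : W2 R) : tr n (x + y) = tr n x + tr n y := by
  unfold tr
  rw [← Finset.sum_add_distrib]
  exact Finset.sum_congr rfl fun i _ => frob_iter_add i x y

theorem tr_succ (n : ℕ) (x : W2 R) : tr (n + 1) x = tr n x + frob^[n] x := by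
  unfold tr
  rw [Finset.sum_range_succ]

theorem tr_double (h : ℕ) (x : W2 R) : tr (2 * h) x = tr h (x + frob^[h] x) := by
  rw [tr_add, two_mul]
  unfold tr
  rw [Finset.sum_range_add]
  congr 1
  apply Finset.sum_congr rfl
  intro i _
  rw [add_comm h i, Function.iterate_add_apply]

theorem tr_frob (n : ℕ) (x : W2 R) (hx : frob^[n] x = x) : tr n (frob x) = tr n x := by
  have h1 : tr (n + 1) x = tr n (frob x) + x := by
    unfold tr
    rw [Finset.sum_range_succ']
    simp
  rw [tr_succ, hx] at h1
  exact (add_right_cancel h1).symm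

theorem frob_zero : frob (0 : W2 R) = 0 := by
  apply ext'
  · change (0 : R) ^ 2 = 0
    simp
  · change (0 : R) ^ 2 = 0
    simp

theorem frob_tr' (n : ℕ) (x : W2 R) : frob (tr n x) = tr n (frob x) := by
  induction n with
  | zero =>
    unfold tr
    simp [frob_zero]
  | succ n ih =>
    rw [tr_succ, tr_succ, frob_add, ih, ← Function.iterate_succ_apply, Function.iterate_succ_apply']

theorem tr_zero_left (n : ℕ) (z : R) :
    tr n (W2.mk 0 z) = mk 0 (∑ i ∈ Finset.range n, z ^ 2 ^ i) := by
  induction n with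
  | zero => rfl
  | succ n ih =>
    rw [tr_succ, ih, frob_iter, Finset.sum_range_succ]
    apply ext'
    · simp [fst_add, fst_mk]
    · simp [snd_add, fst_mk, snd_mk]

end W2

section fld
variable {K : Type*} [Field K] [CharP K 2]

theorem zo {x : K} (h : x ^ 2 = x) : x = 0 ∨ x = 1 := by
  have : x * (x - 1) = 0 := by linear_combination h
  rcases mul_eq_zero.1 this with h | h
  · exact Or.inl h
  · exact Or.inr (sub_eq_zero.1 h)

theorem W2.xi_add (I : ℂ) (hI : I ^ 2 = -1) (x y : W2 K) (hx : W2.frob x = x)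
    (hy : W2.frob y = y) : W2.xi I (x + y) = W2.xi I x * W2.xi I y := by
  have h2 : (1 + 1 : K) = 0 := CharTwo.add_self_eq_zero 1
  have hI' : I * I = -1 := by rw [← sq, hI]
  have a := zo (congrArg Prod.fst hx : x.1 ^ 2 = x.1)
  have b := zo (congrArg Prod.snd hx : x.2 ^ 2 = x.2)
  have c := zo (congrArg Prod.fst hy : y.1 ^ 2 = y.1)
  have d := zo (congrArg Prod.snd hy : y.2 ^ 2 = y.2)
  unfold W2.xi
  rw [W2.fst_add, W2.snd_add]
  rcases a with a | a <;> rcases b with b | b <;> rcases c with c | c <;> rcases d with d | d <;>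
    rw [a, b, c, d] <;> simp [h2, hI']

variable (n : ℕ)

theorem tr2_add (x y : K) : tr2 n (x + y) = tr2 n x + tr2 n y := by
  unfold tr2
  rw [← Finset.sum_add_distrib]
  exact Finset.sum_congr rfl fun i _ => add_pow_char_pow x y 2 i

theorem tr2_zero : tr2 n (0 : K) = 0 := by
  unfold tr2
  simp

theorem tr2_sum {ι : Type*} (s : Finset ι) (f : ι → K) :
    tr2 n (∑ i ∈ s, f i) = ∑ i ∈ s, tr2 n (f i) := by
  induction s using Finset.induction_on with
  | empty => simp [tr2_zero]
  | insert a s ha ih => rw [Finset.sum_insert ha, Finset.sum_insert ha, tr2_add, ih]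

theorem tr2_sq' (x : K) : tr2 n (x ^ 2) + x = tr2 n x + x ^ 2 ^ n := by
  have h1 : tr2 (n + 1) x = tr2 n (x ^ 2) + x := by
    unfold tr2
    rw [Finset.sum_range_succ']
    simp only [pow_zero, pow_one]
    congr 1
    apply Finset.sum_congr rfl
    intro i _
    rw [← pow_mul, pow_succ' 2 i]
  rw [← h1]
  unfold tr2
  rw [Finset.sum_range_succ]

theorem sq_tr2 (x : K) : (tr2 n x) ^ 2 = tr2 n (x ^ 2) := by
  unfold tr2
  rw [sum_pow_char 2]
  apply Finset.sum_congr rfl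
  intro i _
  rw [← pow_mul, ← pow_mul, mul_comm]

theorem tr2_double (h : ℕ) (x : K) : tr2 (2 * h) x = tr2 h (x + x ^ 2 ^ h) := by
  rw [tr2_add, two_mul]
  unfold tr2
  rw [Finset.sum_range_add]
  congr 1
  apply Finset.sum_congr rfl
  intro i _
  rw [← pow_mul, ← pow_add]

variable [Fintype K]

theorem pow_q (hc : Fintype.card K = 2 ^ n) (x : K) : x ^ 2 ^ n = x := by
  rw [← hc]; exact FiniteField.pow_card x

theorem tr2_sq (hc : Fintype.card K = 2 ^ n) (x : K) : tr2 n (x ^ 2) = tr2 n x := by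
  have := tr2_sq' n x
  rw [pow_q n hc] at this
  exact add_right_cancel this

theorem tr2_zo (hc : Fintype.card K = 2 ^ n) (x : K) : tr2 n x = 0 ∨ tr2 n x = 1 :=
  zo (by rw [sq_tr2, tr2_sq n hc])

theorem psi_add (hc : Fintype.card K = 2 ^ n) (x y : K) : psiq n (x + y) = psiq n x * psiq n y := by
  have h2 : (1 + 1 : K) = 0 := CharTwo.add_self_eq_zero 1
  unfold psiq
  rw [tr2_add]
  rcases tr2_zo n hc x with a | a <;> rcases tr2_zo n hc y with b | b <;> rw [a, b] <;> simp [h2]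

theorem psi_mul_self (x : K) : psiq n x * psiq n x = 1 := by
  unfold psiq
  split_ifs <;> simp

theorem psi_zero : psiq n (0 : K) = 1 := by
  unfold psiq
  simp [tr2_zero]

/-- existence of an element of trace one -/
theorem exists_tr_one (hc : Fintype.card K = 2 ^ n) (hn : 1 ≤ n) : ∃ x : K, tr2 n x = 1 := by
  by_contra hcon
  push Not at hcon
  have h0 : ∀ x : K, tr2 n x = 0 := fun x => (tr2_zo n hc x).resolve_right (hcon x)
  let P : Polynomial K := ∑ i ∈ Finset.range n, Polynomial.X ^ 2 ^ i
  have hdeg : P.natDegree < Fintype.card K := by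
    rw [hc]
    apply lt_of_le_of_lt (Polynomial.natDegree_sum_le_of_forall_le (n := 2 ^ (n - 1)) _ _ _)
    · exact Nat.pow_lt_pow_right (by norm_num) (by omega)
    · intro i hi
      rw [Polynomial.natDegree_X_pow]
      exact Nat.pow_le_pow_right (by norm_num) (by have := Finset.mem_range.1 hi; omega)
  have hP : P = 0 := by
    apply Polynomial.eq_zero_of_natDegree_lt_card_of_eval_eq_zero P (f := (id : K → K))
      Function.injective_id
    · intro x
      have := h0 x
      simpa [P, Polynomial.eval_finsetSum, tr2] using this
    · exact hdeg
  have hco : P.coeff 1 = 1 := by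
    simp only [P, Polynomial.finsetSum_coeff, Polynomial.coeff_X_pow]
    rw [Finset.sum_eq_single 0]
    · simp
    · intro i _ hi
      rw [if_neg]
      intro h
      exact hi ((Nat.pow_eq_one.1 h.symm).resolve_left (by norm_num))
    · intro h
      exact absurd (Finset.mem_range.2 (by omega)) h
  rw [hP] at hco
  simp at hco

theorem psi_orth (hc : Fintype.card K = 2 ^ n) (hn : 1 ≤ n) (a : K) :
    ∑ x : K, psiq n (a * x) = if a = 0 then (Fintype.card K : ℂ) else 0 := by
  split_ifs with ha
  · subst ha
    simp [psi_zero]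
  · obtain ⟨z, hz⟩ := exists_tr_one n hc hn
    have hb : psiq n z = -1 := by
      unfold psiq
      simp [hz]
    have h1 : ∑ x : K, psiq n (a * x) = ∑ x : K, psiq n (a * (x + a⁻¹ * z)) :=
      (Equiv.sum_comp (Equiv.addRight (a⁻¹ * z)) (fun x => psiq n (a * x))).symm
    have h2 : ∀ x, psiq n (a * (x + a⁻¹ * z)) = - psiq n (a * x) := by
      intro x
      rw [mul_add, mul_inv_cancel_left₀ ha, psi_add n hc, hb]
      ring
    simp only [h2, Finset.sum_neg_distrib] at h1
    have h3 : 2 * ∑ x : K, psiq n (a * x) = 0 := by linear_combination h1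
    simpa using h3

/-- Fibre lemma. -/
theorem fibre (hc : Fintype.card K = 2 ^ n) (hn : 1 ≤ n) (L M : K → K) (hLM : ∀ u x, psiq n (u * L x) = psiq n (M u * x))
    (y : K) :
    ∑ x : K, (if L x = y then (1 : ℂ) else 0)
      = ∑ u : K, if M u = 0 then psiq n (u * y) else 0 := by
  have hq : (Fintype.card K : ℂ) ≠ 0 := by
    exact_mod_cast Fintype.card_ne_zero
  apply mul_left_cancel₀ hq
  have h1 : ∀ x, (Fintype.card K : ℂ) * (if L x = y then (1 : ℂ) else 0)
      = ∑ u : K, psiq n (u * L x) * psiq n (u * y) := by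
    intro x
    have := psi_orth n hc hn (L x + y)
    simp only [← psi_add n hc, ← mul_add]
    simp only [mul_comm (L x + y)] at this
    rw [this]
    have e : L x + y = 0 ↔ L x = y := by
      rw [CharTwo.add_eq_zero]
    simp [e]
  rw [Finset.mul_sum, Finset.mul_sum]
  simp only [h1]
  rw [Finset.sum_comm]
  apply Finset.sum_congr rfl
  intro u _
  rw [← Finset.sum_mul]
  simp only [hLM]
  rw [psi_orth n hc hn]
  split_ifs <;> simp

theorem fibre_sum (hc : Fintype.card K = 2 ^ n) (hn : 1 ≤ n) (L M : K → K) (hLM : ∀ u x, psiq n (u * L x) = psiq n (M u * x))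
    (f : K → ℂ) :
    ∑ x : K, f (L x) = ∑ u : K, if M u = 0 then ∑ y : K, f y * psiq n (u * y) else 0 := by
  have h1 : ∀ x, f (L x) = ∑ y : K, f y * (if L x = y then (1 : ℂ) else 0) := by
    intro x
    simp
  simp only [h1]
  rw [Finset.sum_comm]
  simp only [← Finset.mul_sum, fibre n hc hn L M hLM]
  simp only [Finset.mul_sum]
  rw [Finset.sum_comm]
  apply Finset.sum_congr rfl
  intro u _
  split_ifs <;> simp


theorem wfix (hc : Fintype.card K = 2 ^ n) (x : W2 K) : W2.frob^[n] x = x := by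
  obtain ⟨a, b⟩ := x
  have := W2.frob_iter n a b
  rw [pow_q n hc, pow_q n hc] at this
  exact this

theorem frob_tr (hc : Fintype.card K = 2 ^ n) (x : W2 K) : W2.frob (W2.tr n x) = W2.tr n x := by
  rw [W2.frob_tr', W2.tr_frob n x (wfix n hc x)]

theorem xi_zero_left (I : ℂ) (z : K) : W2.xi I (W2.tr n (W2.mk 0 z)) = psiq n z := by
  rw [W2.tr_zero_left]
  unfold W2.xi psiq tr2
  rw [W2.fst_mk, W2.snd_mk]
  by_cases h : ∑ i ∈ Finset.range n, z ^ 2 ^ i = 0 <;> simp [h]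

theorem w2_split (x y : K) : (W2.mk x 0) + (W2.mk y 0)
    = (W2.mk (x + y) 0) + (W2.mk 0 (x * y)) := by
  apply W2.ext'
  · simp [W2.fst_add, W2.fst_mk]
  · simp [W2.snd_add, W2.fst_mk, W2.snd_mk]

theorem Q_def (I : ℂ) (x : K) : Qq I n x = W2.xi I (W2.tr n (W2.mk x 0)) := rfl

theorem Q_add (hc : Fintype.card K = 2 ^ n) (I : ℂ) (hI : I ^ 2 = -1) (x y : K) :
    Qq I n (x + y) * psiq n (x * y) = Qq I n x * Qq I n y := by
  simp only [Q_def]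
  rw [← xi_zero_left n I, ← W2.xi_add I hI _ _ (frob_tr n hc _) (frob_tr n hc _),
    ← W2.xi_add I hI _ _ (frob_tr n hc _) (frob_tr n hc _), ← W2.tr_add, ← W2.tr_add, w2_split]

theorem Q_add' (hc : Fintype.card K = 2 ^ n) (I : ℂ) (hI : I ^ 2 = -1) (x y : K) :
    Qq I n (x + y) = Qq I n x * Qq I n y * psiq n (x * y) := by
  rw [← Q_add n hc I hI, mul_assoc, psi_mul_self, mul_one]

theorem Q_sq (hc : Fintype.card K = 2 ^ n) (I : ℂ) (x : K) : Qq I n (x ^ 2) = Qq I n x := by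
  simp only [Q_def]
  have : (W2.mk (x ^ 2) 0) = W2.frob (W2.mk x 0) := by
    rw [W2.frob_mk]
    simp
  rw [this, W2.tr_frob n _ (wfix n hc _)]

theorem Q_zero (I : ℂ) : Qq I n (0 : K) = 1 := by
  simp only [Q_def]
  rw [xi_zero_left, psi_zero]

theorem xi_one (I : ℂ) (hI : I ^ 2 = -1) (j : ℕ) :
    W2.xi I (W2.tr j (W2.mk (1 : K) 0)) = I ^ j ∧
    W2.frob (W2.tr j (W2.mk (1 : K) 0)) = (W2.tr j (W2.mk (1 : K) 0)) := by
  have hf : W2.frob (W2.mk (1 : K) 0) = (W2.mk (1 : K) 0) := by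
    rw [W2.frob_mk]; simp
  induction j with
  | zero =>
    refine ⟨?_, ?_⟩
    · change W2.xi I (W2.mk (0 : K) 0) = _
      unfold W2.xi
      simp [W2.fst_mk, W2.snd_mk]
    · exact W2.frob_zero
  | succ j ih =>
    have hf' : W2.frob^[j] (W2.mk (1 : K) 0) = (W2.mk (1 : K) 0) := by
      rw [W2.frob_iter]; simp
    rw [W2.tr_succ, hf']
    refine ⟨?_, ?_⟩
    · rw [W2.xi_add I hI _ _ ih.2 hf, ih.1, pow_succ]
      congr 1
      unfold W2.xi
      simp [W2.fst_mk, W2.snd_mk]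
    · rw [W2.frob_add, ih.2, hf]

end fld

section gauss
variable {K : Type*} [Field K] [CharP K 2] [Fintype K]

theorem shift_sum (n : ℕ) (hc : Fintype.card K = 2 ^ n) (I : ℂ) (hI : I ^ 2 = -1) (t : K) :
    Qq I n t * ∑ x : K, Qq I n x * psiq n (t * x) = ∑ x : K, Qq I n x := by
  rw [← Equiv.sum_comp (Equiv.addRight t) (fun x => Qq I n x), Finset.mul_sum]
  apply Finset.sum_congr rfl
  intro x _
  rw [Equiv.coe_addRight, Q_add' n hc I hI, mul_comm t x]
  ring

/-- If `G = Q ψ(t ·)` is `1` on the kernel of `M`, then the sum over `L x` is computed. -/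
theorem sum_GL (n : ℕ) (hn : 1 ≤ n) (hc : Fintype.card K = 2 ^ n) (I : ℂ) (hI : I ^ 2 = -1) (t : K)
    (L M : K → K) (hLM : ∀ u x, psiq n (u * L x) = psiq n (M u * x))
    (hM : ∀ u, M u = 0 → Qq I n u = psiq n (t * u)) :
    ∑ x : K, Qq I n (L x) * psiq n (t * L x)
      = (∑ u : K, if M u = 0 then (1 : ℂ) else 0) * ∑ x : K, Qq I n x * psiq n (t * x) := by
  rw [fibre_sum n hc hn L M hLM (fun y => Qq I n y * psiq n (t * y)), Finset.sum_mul]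
  apply Finset.sum_congr rfl
  intro u _
  split_ifs with hu
  · rw [one_mul, ← Equiv.sum_comp (Equiv.addRight u) (fun x => Qq I n x * psiq n (t * x))]
    apply Finset.sum_congr rfl
    intro x _
    rw [Equiv.coe_addRight, Q_add' n hc I hI, mul_add, psi_add n hc, hM u hu, mul_comm u x]
    linear_combination (-(Qq I n x * psiq n (t * x) * psiq n (x * u))) * psi_mul_self n (t * u)
  · simp

theorem gauss (h : ℕ) (hh : 1 ≤ h) (hc : Fintype.card K = 2 ^ (2 * h)) (I : ℂ) (hI : I ^ 2 = -1) :
    ∑ x : K, Qq I (2 * h) x = -(I ^ h * 2 ^ h) := by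
  have hn : 1 ≤ 2 * h := by omega
  have h2 : (2 : K) = 0 := CharTwo.two_eq_zero
  have hrr : ∀ x : K, (x ^ 2 ^ h) ^ 2 ^ h = x := by
    intro x
    rw [← pow_mul, ← pow_add, ← two_mul, pow_q (2 * h) hc]
  obtain ⟨z, hz⟩ := exists_tr_one (2 * h) hc hn
  obtain ⟨s, hs⟩ : ∃ s : K, s ^ 2 ^ h = s + 1 := by
    refine ⟨tr2 h z, ?_⟩
    rw [tr2_double, tr2_add] at hz
    have : (tr2 h z) ^ 2 ^ h = tr2 h (z ^ 2 ^ h) := by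
      unfold tr2
      rw [sum_pow_char_pow 2]
      apply Finset.sum_congr rfl
      intro i _
      rw [← pow_mul, ← pow_mul, mul_comm]
    rw [this]
    linear_combination hz - (tr2 h z) * h2
  set L : K → K := fun x => x ^ 2 ^ h + x with hL
  have hker : ∀ u, L u = 0 ↔ u ^ 2 ^ h = u := by
    intro u
    simp only [hL]
    rw [CharTwo.add_eq_zero]
  have hLM : ∀ u x, psiq (2 * h) (u * L x) = psiq (2 * h) (L u * x) := by
    intro u x
    unfold psiq
    rw [tr2_double, tr2_double]
    simp only [hL, mul_pow, add_pow_char_pow, hrr]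
    have : u * (x ^ 2 ^ h + x) + u ^ 2 ^ h * (x + x ^ 2 ^ h)
      = (u ^ 2 ^ h + u) * x + (u + u ^ 2 ^ h) * x ^ 2 ^ h := by ring
    rw [this]
  have hLL : ∀ x, L (L x) = 0 := by
    intro x
    rw [hker]
    simp only [hL, add_pow_char_pow, hrr]
    ring
  have hQ : ∀ u, L u = 0 → Qq I (2 * h) u = psiq (2 * h) (s * u) := by
    intro u hu
    rw [hker] at hu
    have e1 : W2.mk u 0 + W2.frob^[h] (W2.mk u 0) = W2.mk 0 (u ^ 2) := by
      rw [W2.frob_iter, hu]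
      apply W2.ext'
      · rw [W2.fst_add, W2.fst_mk, W2.fst_mk, W2.fst_mk]
        exact CharTwo.add_self_eq_zero u
      · rw [W2.snd_add]
        simp only [W2.fst_mk, W2.snd_mk]
        rw [zero_pow (by positivity)]
        ring
    rw [Q_def, W2.tr_double, e1, xi_zero_left]
    unfold psiq
    rw [tr2_double h (s * u), mul_pow, hu, hs]
    have e2 : s * u + (s + 1) * u = u := by linear_combination (s * u) * h2
    rw [e2]
    have e3 := tr2_sq' h u
    rw [hu] at e3
    rw [add_right_cancel e3]
  have hψ1 : ∀ u y, L u = 0 → L y = 0 → psiq (2 * h) (u * y) = 1 := by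
    intro u y hu hy
    rw [hker] at hu hy
    unfold psiq
    rw [tr2_double, mul_pow, hu, hy, CharTwo.add_self_eq_zero, tr2_zero, if_pos rfl]
  set c : ℂ := ∑ u : K, if L u = 0 then (1 : ℂ) else 0 with hcdef
  have hcc : ((2 : ℂ) ^ (2 * h)) = c * c := by
    have := fibre_sum (2 * h) hc hn L L hLM (fun y => if L y = 0 then (1 : ℂ) else 0)
    simp only [hLL, if_true] at this
    have e : ∑ x : K, (1 : ℂ) = 2 ^ (2 * h) := by
      simp [hc]
    rw [e] at this
    rw [this, hcdef, Finset.sum_mul]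
    apply Finset.sum_congr rfl
    intro u _
    split_ifs with hu
    · rw [one_mul]
      apply Finset.sum_congr rfl
      intro y _
      split_ifs with hy
      · rw [hψ1 u y hu hy, one_mul]
      · simp
    · simp
  have hcn : ∃ N : ℕ, c = N := by
    refine ⟨#{u : K | L u = 0}, ?_⟩
    rw [hcdef, Finset.sum_boole]
  obtain ⟨N, hN⟩ := hcn
  have hN2 : N = 2 ^ h := by
    rw [hN] at hcc
    have : (2 ^ h) ^ 2 = N ^ 2 := by
      rw [← pow_mul, mul_comm h 2, sq N]
      exact_mod_cast hcc
    exact ((Nat.pow_left_injective (n := 2) (by norm_num)) this).symm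
  have hc2 : c = 2 ^ h := by rw [hN, hN2]; push_cast; rfl
  have hG := sum_GL (2 * h) hn hc I hI s L L hLM hQ
  have hG1 : ∀ x, Qq I (2 * h) (L x) * psiq (2 * h) (s * L x) = 1 := by
    intro x
    rw [hQ _ (hLL x), psi_mul_self]
  simp only [hG1] at hG
  have e : ∑ x : K, (1 : ℂ) = 2 ^ h * 2 ^ h := by
    simp [hc, two_mul, pow_add]
  rw [e, ← hcdef, hc2] at hG
  have hG' := mul_left_cancel₀ (pow_ne_zero h two_ne_zero) hG
  rw [← shift_sum (2 * h) hc I hI s, ← hG']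
  have e1 : W2.mk s 0 + W2.frob^[h] (W2.mk s 0) = W2.mk 1 0 + W2.mk 0 (s ^ 2 + s) := by
    rw [W2.frob_iter, hs]
    apply W2.ext'
    · simp only [W2.fst_add, W2.fst_mk]
      linear_combination s * h2
    · simp only [W2.snd_add, W2.fst_mk, W2.snd_mk]
      rw [zero_pow (by positivity)]
      ring
  have e2 : tr2 h (s ^ 2 + s) = 1 := by
    rw [tr2_add]
    have := tr2_sq' h s
    rw [hs] at this
    linear_combination this + (tr2 h s) * h2
  have e3 : Qq I (2 * h) s = - I ^ h := by
    rw [Q_def, W2.tr_double, e1, W2.tr_add, W2.xi_add I hI _ _ (xi_one I hI h).2,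
      (xi_one I hI h).1, xi_zero_left]
    · unfold psiq
      rw [e2]
      simp
    · rw [W2.tr_zero_left, W2.frob_mk]
      unfold tr2 at e2
      rw [e2]
      simp
  rw [e3]
  ring

theorem Q_one (h : ℕ) (I : ℂ) (hI : I ^ 2 = -1) : Qq I (2 * h) (1 : K) = I ^ h * I ^ h := by
  rw [Q_def, (xi_one I hI (2 * h)).1, two_mul, pow_add]

end gauss

section roots
variable {K : Type*} [Field K] [CharP K 2] [Fintype K]

theorem rt_succ (j : ℕ) (x : K) : rt K (j + 1) x = (frobeniusEquiv K 2).symm (rt K j x) := by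
  unfold rt
  rw [Function.iterate_succ_apply']

theorem rt_add_idx (i j : ℕ) (x : K) : rt K (i + j) x = rt K i (rt K j x) := by
  unfold rt
  rw [Function.iterate_add_apply]

theorem rt_add (j : ℕ) (x y : K) : rt K j (x + y) = rt K j x + rt K j y := by
  induction j with
  | zero => rfl
  | succ j ih => rw [rt_succ, rt_succ, rt_succ, ih, map_add]

theorem rt_mul (j : ℕ) (x y : K) : rt K j (x * y) = rt K j x * rt K j y := by
  induction j with
  | zero => rfl
  | succ j ih => rw [rt_succ, rt_succ, rt_succ, ih, map_mul]

theorem rt_zero (j : ℕ) : rt K j (0 : K) = 0 := by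
  induction j with
  | zero => rfl
  | succ j ih => rw [rt_succ, ih, map_zero]

theorem rt_one (j : ℕ) : rt K j (1 : K) = 1 := by
  induction j with
  | zero => rfl
  | succ j ih => rw [rt_succ, ih, map_one]

theorem rt_sum (j : ℕ) {ι : Type*} (s : Finset ι) (f : ι → K) :
    rt K j (∑ i ∈ s, f i) = ∑ i ∈ s, rt K j (f i) := by
  induction s using Finset.induction_on with
  | empty => simp [rt_zero]
  | insert a s ha ih => rw [Finset.sum_insert ha, Finset.sum_insert ha, rt_add, ih]

theorem rt_pow (j : ℕ) (x : K) : (rt K j x) ^ 2 ^ j = x := by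
  induction j generalizing x with
  | zero => simp [rt]
  | succ j ih =>
    rw [rt_succ, pow_succ' 2 j, pow_mul]
    have : ((frobeniusEquiv K 2).symm (rt K j x)) ^ 2 = rt K j x :=
      (frobeniusEquiv K 2).apply_symm_apply (rt K j x)
    rw [this, ih]

theorem pow_rt (j : ℕ) (x : K) : rt K j (x ^ 2 ^ j) = x := by
  have h := rt_pow j (x ^ 2 ^ j)
  exact (iterateFrobenius_inj K 2 j) h

theorem rt_eq_zero (j : ℕ) (x : K) : rt K j x = 0 ↔ x = 0 := by
  constructor
  · intro h
    rw [← rt_pow j x, h, zero_pow (by positivity)]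
  · rintro rfl
    exact rt_zero j

variable (n : ℕ)

theorem tr2_pow (hc : Fintype.card K = 2 ^ n) (j : ℕ) (x : K) : tr2 n (x ^ 2 ^ j) = tr2 n x := by
  induction j with
  | zero => simp
  | succ j ih => rw [pow_succ, pow_mul, tr2_sq n hc, ih]

theorem tr2_rt (hc : Fintype.card K = 2 ^ n) (j : ℕ) (x : K) : tr2 n (rt K j x) = tr2 n x := by
  rw [← tr2_pow n hc j, rt_pow]

theorem Q_pow (hc : Fintype.card K = 2 ^ n) (I : ℂ) (j : ℕ) (x : K) : Qq I n (x ^ 2 ^ j) = Qq I n x := by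
  induction j with
  | zero => simp
  | succ j ih => rw [pow_succ, pow_mul, Q_sq n hc, ih]

theorem Q_rt (hc : Fintype.card K = 2 ^ n) (I : ℂ) (j : ℕ) (x : K) : Qq I n (rt K j x) = Qq I n x := by
  rw [← Q_pow n hc I j, rt_pow]

theorem adj_tr (hc : Fintype.card K = 2 ^ n) (k e : ℕ) (b : ℕ → K) (u x : K) :
    tr2 n (u * Lpoly (2 ^ k) e b x) = tr2 n (adj k e b u * x) := by
  unfold Lpoly adj
  rw [Finset.mul_sum, Finset.sum_mul, tr2_sum, tr2_sum]
  apply Finset.sum_congr rfl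
  intro i _
  rw [← tr2_rt n hc (k * i)]
  congr 1
  rw [← pow_mul 2 k i, ← mul_assoc, rt_mul _ _ (x ^ _), pow_rt, mul_comm u]

/-- Iterated quadratic identity. -/
theorem Q_sum (hc : Fintype.card K = 2 ^ n) (I : ℂ) (hI : I ^ 2 = -1) (N : ℕ) (u : ℕ → K) :
    Qq I n (∑ i ∈ Finset.range N, u i)
      = (∏ i ∈ Finset.range N, Qq I n (u i))
        * psiq n (∑ j ∈ Finset.range N, ∑ i ∈ Finset.range j, u i * u j) := by
  induction N with
  | zero => simp [Q_zero, psi_zero]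
  | succ N ih =>
    rw [Finset.sum_range_succ, Finset.prod_range_succ, Finset.sum_range_succ, psi_add n hc,
      Q_add' n hc I hI, ih, Finset.sum_mul]
    ring

theorem tri_swap (e : ℕ) (f : ℕ → ℕ → K) :
    ∑ j ∈ Finset.range (e + 1), ∑ i ∈ Finset.range j, f i j
      = ∑ i ∈ Finset.range (e + 1), ∑ j ∈ Finset.Ioo i (e + 1), f i j := by
  apply Finset.sum_comm'
  intro x y
  simp only [Finset.mem_range, Finset.mem_Ioo]
  omega

theorem tri_diag (e : ℕ) (f : ℕ → ℕ → K) :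
    ∑ d ∈ Finset.Icc 1 e, ∑ j ∈ Finset.range (e - d + 1), f j (j + d)
      = ∑ i ∈ Finset.range (e + 1), ∑ j ∈ Finset.Ioo i (e + 1), f i j := by
  rw [Finset.sum_sigma', Finset.sum_sigma']
  refine Finset.sum_bij' (fun a _ => ⟨a.2, a.2 + a.1⟩) (fun a _ => ⟨a.2 - a.1, a.1⟩) ?_ ?_ ?_ ?_ ?_
  · rintro ⟨d, j⟩ h
    simp only [Finset.mem_sigma, Finset.mem_Icc, Finset.mem_range, Finset.mem_Ioo] at h ⊢
    omega
  · rintro ⟨d, j⟩ h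
    simp only [Finset.mem_sigma, Finset.mem_Icc, Finset.mem_range, Finset.mem_Ioo] at h ⊢
    omega
  · rintro ⟨d, j⟩ h
    simp
  · rintro ⟨d, j⟩ h
    simp only [Finset.mem_sigma, Finset.mem_Icc, Finset.mem_range, Finset.mem_Ioo] at h
    have : d + (j - d) = j := by omega
    simp [this]
  · rintro ⟨d, j⟩ h
    rfl

theorem tr_RF (hc : Fintype.card K = 2 ^ n) (k e : ℕ) (b : ℕ → K) (x : K) :
    tr2 n (x * RF k e b x) = tr2 n (∑ j ∈ Finset.range (e + 1), ∑ i ∈ Finset.range j,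
      (b i * x ^ (2 ^ k) ^ i) * (b j * x ^ (2 ^ k) ^ j)) := by
  rw [tri_swap e (fun i j => (b i * x ^ (2 ^ k) ^ i) * (b j * x ^ (2 ^ k) ^ j)), ← tri_diag]
  unfold RF aRF
  rw [Finset.mul_sum, tr2_sum, tr2_sum]
  apply Finset.sum_congr rfl
  intro d _
  rw [Finset.sum_mul, Finset.mul_sum, tr2_sum, tr2_sum]
  apply Finset.sum_congr rfl
  intro j _
  rw [← tr2_rt n hc (k * j) (b j * _ * _)]
  congr 1
  have e1 : b j * x ^ (2 ^ k) ^ j * (b (j + d) * x ^ (2 ^ k) ^ (j + d))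
    = b j * b (j + d) * (x * x ^ (2 ^ k) ^ d) ^ 2 ^ (k * j) := by
    rw [pow_add, mul_pow, ← pow_mul 2 k j, mul_comm _ ((2 ^ k) ^ d), pow_mul x]
    ring
  rw [e1, rt_mul _ _ ((x * _) ^ _), pow_rt]
  ring

theorem key (hc : Fintype.card K = 2 ^ n) (I : ℂ) (hI : I ^ 2 = -1) (k e : ℕ) (b : ℕ → K) (t x : K) (h1 : adj k e b 1 = 0) :
    psiq n (x * RFt k e b t x)
      = Qq I n (Lpoly (2 ^ k) e b x) * psiq n (t * Lpoly (2 ^ k) e b x) := by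
  have hψt : psiq n (t * Lpoly (2 ^ k) e b x) = psiq n ((adj k e b t) ^ 2 * x ^ 2) := by
    unfold psiq
    rw [adj_tr n hc, ← mul_pow, tr2_sq n hc]
  have hγ : gammaF k e b * x ^ 2 = ∑ j ∈ Finset.range (e + 1), ∑ i ∈ Finset.range j,
      (rt K (k * i) (b i) * x) * (rt K (k * j) (b j) * x) := by
    rw [tri_swap e (fun i j => (rt K (k * i) (b i) * x) * (rt K (k * j) (b j) * x))]
    unfold gammaF
    rw [Finset.sum_mul]
    apply Finset.sum_congr rfl
    intro i _
    rw [Finset.sum_mul]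
    apply Finset.sum_congr rfl
    intro j _
    ring
  have hv := Q_sum n hc I hI (e + 1) (fun i => rt K (k * i) (b i) * x)
  have hv0 : ∑ i ∈ Finset.range (e + 1), rt K (k * i) (b i) * x = 0 := by
    rw [← Finset.sum_mul]
    unfold adj at h1
    simp only [mul_one] at h1
    rw [h1, zero_mul]
  rw [hv0, Q_zero, ← hγ] at hv
  have hu := Q_sum n hc I hI (e + 1) (fun i => b i * x ^ (2 ^ k) ^ i)
  have hQi : ∀ i, Qq I n (b i * x ^ (2 ^ k) ^ i) = Qq I n (rt K (k * i) (b i) * x) := by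
    intro i
    rw [← Q_rt n hc I (k * i), rt_mul, ← pow_mul 2 k i, pow_rt]
  simp only [hQi] at hu
  have hR : psiq n (x * RF k e b x) = psiq n (∑ j ∈ Finset.range (e + 1), ∑ i ∈ Finset.range j,
      (b i * x ^ (2 ^ k) ^ i) * (b j * x ^ (2 ^ k) ^ j)) := by
    unfold psiq
    rw [tr_RF n hc]
  have hL : Lpoly (2 ^ k) e b x = ∑ i ∈ Finset.range (e + 1), b i * x ^ (2 ^ k) ^ i := rfl
  have hsplit : x * RFt k e b t x = x * RF k e b x + (gammaF k e b * x ^ 2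
      + (adj k e b t) ^ 2 * x ^ 2) := by
    unfold RFt alphaF
    ring
  rw [hψt, hL, hu, ← hR, hsplit, psi_add n hc, psi_add n hc]
  set P := ∏ i ∈ Finset.range (e + 1), Qq I n (rt K (k * i) (b i) * x)
  have hm := psi_mul_self n (gammaF k e b * x ^ 2)
  have hP : P = psiq n (gammaF k e b * x ^ 2) := by
    linear_combination (-psiq n (gammaF k e b * x ^ 2)) * hv - P * hm
  rw [hP]
  ring

theorem adj_bOfW (k e : ℕ) (c : ℕ → K) (u : K) :
    adj k e (bOfW k e c) u = rt K (k * e) (Lpoly (2 ^ k) e c u) := by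
  unfold adj Lpoly
  rw [rt_sum, ← Finset.sum_range_reflect]
  apply Finset.sum_congr rfl
  intro i hi
  have hi : i ≤ e := Nat.lt_succ_iff.1 (Finset.mem_range.1 hi)
  have h1 : e + 1 - 1 - i = e - i := by omega
  have h2 : e - (e - i) = i := by omega
  have h3 : k * e = k * (e - i) + k * i := by rw [← mul_add]; congr 1; omega
  unfold bOfW
  rw [h1, h2, rt_mul, rt_mul, ← rt_add_idx, ← h3]
  congr 1
  rw [h3, rt_add_idx, ← pow_mul 2 k i, pow_rt]

end roots

section count
variable {K : Type*} [Field K] [CharP K 2] [Fintype K]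

theorem card_Fp (k m : ℕ) (hk : 1 ≤ k) (hc : Fintype.card K = 2 ^ (k * m)) :
    #{u : K | u ^ 2 ^ k = u} = 2 ^ k := by
  have h1 : 1 < 2 ^ k := Nat.one_lt_two_pow (by omega)
  have hd : 2 ^ k - 1 ∣ 2 ^ (k * m) - 1 := by
    rw [pow_mul]
    simpa using Nat.sub_dvd_pow_sub_pow (2 ^ k) 1 m
  have hker := IsCyclic.card_powMonoidHom_ker (G := Kˣ) (2 ^ k - 1)
  rw [Nat.card_units, Nat.card_eq_fintype_card (α := K), hc, Nat.gcd_eq_right hd] at hker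
  have hset : ({u : K | u ^ 2 ^ k = u} : Finset K)
      = insert 0 (({u : Kˣ | u ^ (2 ^ k - 1) = 1} : Finset Kˣ).image (fun u : Kˣ => (u : K))) := by
    ext u
    simp only [Finset.mem_filter, Finset.mem_univ, true_and, Finset.mem_insert, Finset.mem_image]
    have hp : u ^ 2 ^ k = u ^ (2 ^ k - 1) * u := by
      rw [← pow_succ]; congr 1; omega
    constructor
    · intro hu
      by_cases h0 : u = 0
      · exact Or.inl h0
      · right
        refine ⟨Units.mk0 u h0, ?_, rfl⟩
        apply Units.ext
        rw [hp] at hu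
        simpa using mul_right_cancel₀ h0 (hu.trans (one_mul u).symm)
    · rintro (rfl | ⟨v, hv, rfl⟩)
      · exact zero_pow (by positivity)
      · have := congrArg (fun w : Kˣ => (w : K)) hv
        rw [hp]
        simp only [Units.val_pow_eq_pow_val, Units.val_one] at this
        rw [this, one_mul]
  rw [hset, Finset.card_insert_of_notMem, Finset.card_image_of_injective _ Units.val_injective]
  · have : #{u : Kˣ | u ^ (2 ^ k - 1) = 1} = 2 ^ k - 1 := by
      refine Eq.trans ?_ hker
      rw [← Fintype.card_subtype, ← Nat.card_eq_fintype_card]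
      rfl
    omega
  · simp

theorem Ncount_eq (k m : ℕ) (hk : 1 ≤ k) (hm : 1 ≤ m) (hc : Fintype.card K = 2 ^ (k * m))
    (R : K → K) (hR : ∀ s x, s ^ 2 ^ k = s → R (s * x) = s * R x) :
    (Ncount K (2 ^ k) R : ℂ)
      = 2 ^ (k * m) + (2 ^ k - 1) * ∑ x : K, psiq (k * m) (x * R x) := by
  have hn : 1 ≤ k * m := Nat.mul_pos hk hm
  have h1 : (Ncount K (2 ^ k) R : ℂ)
      = ∑ x : K, ∑ y : K, if y ^ 2 ^ k - y = x * R x then (1 : ℂ) else 0 := by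
    unfold Ncount
    rw [Nat.card_eq_fintype_card, Fintype.card_subtype, ← Finset.sum_boole,
      ← Finset.univ_product_univ, Finset.sum_product]
  have hLM : ∀ u x : K, psiq (k * m) (u * (x ^ 2 ^ k - x)) = psiq (k * m) ((rt K k u - u) * x) := by
    intro u x
    unfold psiq
    have : tr2 (k * m) (u * (x ^ 2 ^ k - x)) = tr2 (k * m) ((rt K k u - u) * x) := by
      rw [CharTwo.sub_eq_add, CharTwo.sub_eq_add, mul_add, add_mul, tr2_add, tr2_add,
        ← tr2_rt _ hc k (u * x ^ 2 ^ k), rt_mul, pow_rt]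
    rw [this]
  have hM : ∀ u : K, rt K k u - u = 0 ↔ u ^ 2 ^ k = u := by
    intro u
    rw [sub_eq_zero]
    constructor
    · intro h
      conv_rhs => rw [← rt_pow k u, h]
    · intro h
      conv_lhs => rw [← h, pow_rt]
  have h2 : ∀ x, ∑ y : K, (if y ^ 2 ^ k - y = x * R x then (1 : ℂ) else 0)
      = ∑ u : K, if u ^ 2 ^ k = u then psiq (k * m) (u * (x * R x)) else 0 := by
    intro x
    rw [fibre (k * m) hc hn (fun y => y ^ 2 ^ k - y) (fun u => rt K k u - u) hLM]
    simp only [hM]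
  rw [h1]
  simp only [h2]
  rw [Finset.sum_comm]
  set S := ∑ x : K, psiq (k * m) (x * R x) with hS
  have h3 : ∀ u : K, (∑ x : K, if u ^ 2 ^ k = u then psiq (k * m) (u * (x * R x)) else 0)
      = (if u ^ 2 ^ k = u then S else 0) + if u = 0 then (2 : ℂ) ^ (k * m) - S else 0 := by
    intro u
    by_cases h0 : u = 0
    · subst h0
      have : (0 : K) ^ 2 ^ k = 0 := zero_pow (by positivity)
      simp [psi_zero, hc]
    · rw [if_neg h0, add_zero]
      split_ifs with hu
      · set s := rt K 1 u with hs
        have hsu : s ^ 2 = u := by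
          have := rt_pow 1 u
          simpa using this
        have hs0 : s ≠ 0 := by
          intro h
          rw [h] at hsu
          exact h0 (by rw [← hsu]; simp)
        have hsp : s ^ 2 ^ k = s := by
          apply frobenius_inj K 2
          simp only [frobenius_def]
          rw [← pow_mul, mul_comm, pow_mul, hsu, hu]
        rw [hS, ← Equiv.sum_comp (Equiv.mulLeft₀ s hs0) (fun x => psiq (k * m) (x * R x))]
        apply Finset.sum_congr rfl
        intro x _
        rw [Equiv.mulLeft₀_apply, hR s x hsp, ← hsu]
        congr 1
        ring
      · simp
  simp only [h3]
  rw [Finset.sum_add_distrib, Finset.sum_ite_eq' Finset.univ (0 : K) (fun _ => (2 : ℂ) ^ (k * m) - S)]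
  rw [← Finset.sum_filter, Finset.sum_const, card_Fp k m hk hc]
  simp
  ring

end count

end helpers

/-- The linear-algebraic recipe `(W, t) ↦ D_{F_W,t}` produces
`𝔽_q`-extremal curves, maximal iff `Q_q(t) = -(√-1)^{n/2}`. -/
theorem statement9 {K : Type*} [Field K] [Fintype K] [CharP K 2]
    (k m e : ℕ) (hk : 1 ≤ k) (hm : 1 ≤ m) (hmeven : Even m)
    (hcard : Fintype.card K = 2 ^ (k * m))
    (W : Set K) (h1W : (1 : K) ∈ W)
    (haddW : ∀ u ∈ W, ∀ v ∈ W, u + v ∈ W)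
    (hsmulW : ∀ c : K, c ^ 2 ^ k = c → ∀ u ∈ W, c * u ∈ W)
    (hWcard : Nat.card W = (2 ^ k) ^ e)
    (c : ℕ → K)
    (hfW : ∏ v ∈ (Set.toFinite W).toFinset, (Polynomial.X - Polynomial.C v)
      = ∑ i ∈ Finset.range (e + 1), Polynomial.C (c i) * Polynomial.X ^ (2 ^ k) ^ i)
    (I : ℂ) (hI : I ^ 2 = -1)
    (t : K) (ht : ∀ v ∈ W, Qq I (k * m) v = psiq (k * m) (t * v)) :
    ((Ncount K (2 ^ k) (RFt k e (bOfW k e c) t) : ℤ)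
        = 2 ^ (k * m) + (2 ^ k - 1) * (2 ^ k) ^ e * 2 ^ (k * m / 2) ∨
      (Ncount K (2 ^ k) (RFt k e (bOfW k e c) t) : ℤ)
        = 2 ^ (k * m) - (2 ^ k - 1) * (2 ^ k) ^ e * 2 ^ (k * m / 2)) ∧
    ((Ncount K (2 ^ k) (RFt k e (bOfW k e c) t) : ℤ)
        = 2 ^ (k * m) + (2 ^ k - 1) * (2 ^ k) ^ e * 2 ^ (k * m / 2) ↔
      Qq I (k * m) t = -I ^ (k * m / 2)) ∧
    ((Ncount K (2 ^ k) (RFt k e (bOfW k e c) t) : ℤ)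
        = 2 ^ (k * m) - (2 ^ k - 1) * (2 ^ k) ^ e * 2 ^ (k * m / 2) ↔
      Qq I (k * m) t = I ^ (k * m / 2)) := by
  obtain ⟨m', hm'⟩ := hmeven
  obtain ⟨h, hh⟩ : ∃ h, k * m = 2 * h := ⟨k * m', by rw [hm']; ring⟩
  have hn : 1 ≤ k * m := Nat.mul_pos hk hm
  have hh1 : 1 ≤ h := by omega
  have hdiv : k * m / 2 = h := by omega
  have hWf : ∀ u : K, Lpoly (2 ^ k) e c u = 0 ↔ u ∈ W := by
    intro u
    have := congrArg (Polynomial.eval u) hfW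
    rw [Polynomial.eval_prod, Polynomial.eval_finsetSum] at this
    simp only [Polynomial.eval_sub, Polynomial.eval_X, Polynomial.eval_C, Polynomial.eval_mul,
      Polynomial.eval_pow] at this
    unfold Lpoly
    rw [← this, Finset.prod_eq_zero_iff]
    constructor
    · rintro ⟨v, hv, huv⟩
      rw [sub_eq_zero.1 huv]
      exact (Set.Finite.mem_toFinset _).1 hv
    · intro hu
      exact ⟨u, (Set.Finite.mem_toFinset _).2 hu, sub_self u⟩
  have hadj : ∀ u : K, adj k e (bOfW k e c) u = 0 ↔ u ∈ W := by
    intro u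
    rw [adj_bOfW, rt_eq_zero, hWf]
  have hR : ∀ s x : K, s ^ 2 ^ k = s → RFt k e (bOfW k e c) t (s * x)
      = s * RFt k e (bOfW k e c) t x := by
    intro s x hs
    have hsi : ∀ i, s ^ (2 ^ k) ^ i = s := by
      intro i
      induction i with
      | zero => simp
      | succ i ih => rw [pow_succ, pow_mul, ih, hs]
    unfold RFt RF
    rw [mul_add, Finset.mul_sum]
    congr 1
    · apply Finset.sum_congr rfl
      intro i _
      rw [mul_pow, hsi]
      ring
    · ring
  have hN := Ncount_eq k m hk hm hcard (RFt k e (bOfW k e c) t) hR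
  simp only [fun x => key (k * m) hcard I hI k e (bOfW k e c) t x ((hadj 1).2 h1W)] at hN
  rw [sum_GL (k * m) hn hcard I hI t (Lpoly (2 ^ k) e (bOfW k e c)) (adj k e (bOfW k e c))
    (fun u x => by unfold psiq; rw [adj_tr _ hcard])
    (fun u hu => ht u ((hadj u).1 hu))] at hN
  have hcW : (∑ u : K, if adj k e (bOfW k e c) u = 0 then (1 : ℂ) else 0) = (2 ^ k) ^ e := by
    simp only [hadj]
    rw [Finset.sum_boole, ← Fintype.card_subtype, ← Nat.card_eq_fintype_card]
    have : Nat.card {x // x ∈ W} = (2 ^ k) ^ e := hWcard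
    rw [this]
    push_cast
    rfl
  rw [hcW] at hN
  have hG := shift_sum (k * m) hcard I hI t
  have hg : ∑ x : K, Qq I (k * m) x = -(I ^ h * 2 ^ h) := by
    rw [hh]
    exact gauss h hh1 (by rw [hcard, hh]) I hI
  rw [hg] at hG
  have hQ2 : Qq I (k * m) t * Qq I (k * m) t = I ^ h * I ^ h := by
    rw [← Q_add _ hcard I hI, CharTwo.add_self_eq_zero, Q_zero, one_mul,
      ← Q_one (K := K) h I hI, ← hh, ht 1 h1W, mul_one]
    unfold psiq
    rw [← sq, tr2_sq _ hcard]
  have hI0 : I ^ h ≠ 0 := by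
    apply pow_ne_zero
    rintro rfl
    norm_num at hI
  have hIne : I ^ h ≠ -I ^ h := by
    intro hcon
    apply hI0
    have : 2 * I ^ h = 0 := by linear_combination hcon
    simpa using this
  rw [hdiv]
  have hD : (0 : ℤ) < (2 ^ k - 1) * (2 ^ k) ^ e * 2 ^ h := by
    have : (1 : ℤ) < 2 ^ k := one_lt_pow₀ (by norm_num) (by omega)
    have : (0 : ℤ) < 2 ^ k - 1 := by linarith
    positivity
  set D : ℤ := (2 ^ k - 1) * (2 ^ k) ^ e * 2 ^ h with hDdef
  set N := Ncount K (2 ^ k) (RFt k e (bOfW k e c) t) with hNdef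
  set S := ∑ x : K, Qq I (k * m) x * psiq (k * m) (t * x)
  rcases mul_self_eq_mul_self_iff.1 hQ2 with hq | hq
  · have hS : S = -2 ^ h := by
      rw [hq] at hG
      apply mul_left_cancel₀ hI0
      rw [hG]
      ring
    have hfin : (N : ℤ) = 2 ^ (k * m) - D := by
      have : ((N : ℤ) : ℂ) = ((2 ^ (k * m) - D : ℤ) : ℂ) := by
        rw [hDdef]
        push_cast
        rw [hN, hS]
        ring
      exact_mod_cast this
    rw [hfin, hq]
    refine ⟨Or.inr rfl, ⟨fun hcon => by omega, fun hcon => absurd hcon hIne⟩, ⟨fun _ => rfl, fun _ => rfl⟩⟩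
  · have hS : S = 2 ^ h := by
      rw [hq] at hG
      apply mul_left_cancel₀ hI0
      linear_combination -hG
    have hfin : (N : ℤ) = 2 ^ (k * m) + D := by
      have : ((N : ℤ) : ℂ) = ((2 ^ (k * m) + D : ℤ) : ℂ) := by
        rw [hDdef]
        push_cast
        rw [hN, hS]
        ring
      exact_mod_cast this
    rw [hfin, hq]
    refine ⟨Or.inl rfl, ⟨fun _ => rfl, fun _ => rfl⟩, ⟨fun hcon => by omega, fun hcon => absurd hcon.symm hIne⟩⟩

end
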